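/- For every integer n ≥ 10, every 2-edge-colouring of K_n with min{|R|,|B|} ≥ n+1 contains a copy of K_{1,3} ∪ K_2 in which all three edges of the star K_{1,3} are red and the edge of the vertex-disjoint K_2 is blue. -/

import Mathlib

/-- The set of red edges of a 2-edge-colouring of `K_n`
    (`true` = red, `false` = blue). -/
def redEdges (n : ℕ) (c : Sym2 (Fin n) → Bool) : Finset (Sym2 (Fin n)) :=
  (⊤ : SimpleGraph (Fin n)).edgeFinset.filter (fun e => c e = true)

/-- The set of blue edges of a 2-edge-colouring of `K_n`. -/
def blueEdges (n : ℕ) (c : Sym2 (Fin n) → Bool) : Finset (Sym2 (Fin n)) :=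
  (⊤ : SimpleGraph (Fin n)).edgeFinset.filter (fun e => c e = false)

/-- The graph of red edges of a 2-edge-colouring of `K_n`. -/
def redGraph (n : ℕ) (c : Sym2 (Fin n) → Bool) : SimpleGraph (Fin n) where
  Adj u v := u ≠ v ∧ c s(u, v) = true
  symm := ⟨fun u v h => ⟨h.1.symm, Sym2.eq_swap (a := u) (b := v) ▸ h.2⟩⟩
  loopless := ⟨fun _ h => h.1 rfl⟩

instance (n : ℕ) (c : Sym2 (Fin n) → Bool) : DecidableRel (redGraph n c).Adj :=
  fun u v => inferInstanceAs (Decidable (u ≠ v ∧ c s(u, v) = true))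

theorem redGraph_adj {n : ℕ} {c : Sym2 (Fin n) → Bool} {u v : Fin n} :
    (redGraph n c).Adj u v ↔ u ≠ v ∧ c s(u, v) = true :=
  Iff.rfl

theorem redGraph_edgeFinset (n : ℕ) (c : Sym2 (Fin n) → Bool) :
    (redGraph n c).edgeFinset = redEdges n c := by
  ext e
  induction e with
  | _ u v => simp [redEdges, redGraph_adj]

/-- If there are more than `n` red edges, some vertex has red degree at least `3`. -/
theorem exists_three_le_degree_redGraph {n : ℕ} {c : Sym2 (Fin n) → Bool}
    (h : n < (redEdges n c).card) : ∃ v, 3 ≤ (redGraph n c).degree v := by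
  by_contra! hdeg
  have hsum := (redGraph n c).sum_degrees_eq_twice_card_edges
  rw [redGraph_edgeFinset] at hsum
  have hle : ∑ v, (redGraph n c).degree v ≤ ∑ _v : Fin n, 2 :=
    Finset.sum_le_sum fun v _ => Nat.le_of_lt_succ (hdeg v)
  simp only [Finset.sum_const, Finset.card_univ, Fintype.card_fin, smul_eq_mul] at hle
  omega

/-- If there are at least `n` blue edges, every vertex is avoided by some blue edge. -/
theorem exists_blue_edge_avoiding {n : ℕ} {c : Sym2 (Fin n) → Bool}
    (h : n ≤ (blueEdges n c).card) (w : Fin n) :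
    ∃ x y, x ≠ y ∧ w ≠ x ∧ w ≠ y ∧ c s(x, y) = false := by
  by_contra! hcon
  have hsub : blueEdges n c ⊆ (Finset.univ.erase w).image fun u => s(w, u) := by
    intro e he
    induction e with
    | _ x y =>
      simp only [blueEdges, Finset.mem_filter, SimpleGraph.mem_edgeFinset, SimpleGraph.mem_edgeSet,
        SimpleGraph.top_adj] at he
      simp only [Finset.mem_image, Finset.mem_erase, Finset.mem_univ, and_true]
      by_cases hx : w = x
      · exact ⟨y, hx ▸ he.1.symm, by rw [hx]⟩
      by_cases hy : w = y
      · exact ⟨x, hy ▸ he.1, by rw [hy, Sym2.eq_swap]⟩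
      exact absurd he.2 (hcon x y he.1 hx hy)
  have hle := (Finset.card_le_card hsub).trans Finset.card_image_le
  rw [Finset.card_erase_of_mem (Finset.mem_univ w), Finset.card_univ, Fintype.card_fin] at hle
  have := w.pos
  omega

/-- A vertex of red degree at least `5` and a blue edge avoiding it give a red star
and an independent blue edge. -/
theorem exists_redStar_blueEdge_of_five_le_degree {n : ℕ} {c : Sym2 (Fin n) → Bool} {w x y : Fin n}
    (hw : 5 ≤ (redGraph n c).degree w) (hxy : x ≠ y) (hx : w ≠ x) (hy : w ≠ y)
    (hc : c s(x, y) = false) :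
    ∃ v a₁ a₂ a₃ x y : Fin n, ([v, a₁, a₂, a₃, x, y] : List (Fin n)).Nodup ∧
      c s(v, a₁) = true ∧ c s(v, a₂) = true ∧ c s(v, a₃) = true ∧ c s(x, y) = false := by
  have hcard : 2 < ((redGraph n c).neighborFinset w \ {x, y}).card := by
    have h₁ := Finset.le_card_sdiff {x, y} ((redGraph n c).neighborFinset w)
    have h₂ : ({x, y} : Finset (Fin n)).card ≤ 2 := Finset.card_le_two
    rw [SimpleGraph.card_neighborFinset_eq_degree] at h₁
    omega
  obtain ⟨a₁, a₂, a₃, h₁, h₂, h₃, h₁₂, h₁₃, h₂₃⟩ := Finset.two_lt_card_iff.1 hcard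
  simp only [Finset.mem_sdiff, SimpleGraph.mem_neighborFinset, redGraph_adj, Finset.mem_insert,
    Finset.mem_singleton, not_or] at h₁ h₂ h₃
  refine ⟨w, a₁, a₂, a₃, x, y, ?_, h₁.1.2, h₂.1.2, h₃.1.2, hc⟩
  simp only [List.nodup_cons, List.mem_cons, List.not_mem_nil, or_false, not_or, List.nodup_nil,
    not_false_eq_true, and_true]
  tauto

/-- For every `n ≥ 10`, every 2-edge-colouring of `K_n` with `min{|R|,|B|} ≥ n+1` contains a
copy of `K_{1,3} ∪ K_2` (six distinct vertices: a star with centre `v` and leaves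
`a₁,a₂,a₃`, plus an independent edge `xy`) in which the three star edges are red and the
independent edge is blue. -/
theorem redStar_blueEdge_K13_union_K2 (n : ℕ) (hn : 10 ≤ n) (c : Sym2 (Fin n) → Bool)
    (h : n + 1 ≤ min (redEdges n c).card (blueEdges n c).card) :
    ∃ v a₁ a₂ a₃ x y : Fin n, ([v, a₁, a₂, a₃, x, y] : List (Fin n)).Nodup ∧
      c s(v, a₁) = true ∧ c s(v, a₂) = true ∧ c s(v, a₃) = true ∧ c s(x, y) = false := by
  obtain ⟨hR, hB⟩ := le_min_iff.1 h
  obtain ⟨v, hv⟩ := exists_three_le_degree_redGraph (Nat.lt_of_succ_le hR)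
  rw [← SimpleGraph.card_neighborFinset_eq_degree] at hv
  obtain ⟨a₁, a₂, a₃, h₁, h₂, h₃, h₁₂, h₁₃, h₂₃⟩ := Finset.two_lt_card_iff.1 hv
  simp only [SimpleGraph.mem_neighborFinset, redGraph_adj] at h₁ h₂ h₃
  by_contra hcon
  have hS : 6 ≤ (({v, a₁, a₂, a₃} : Finset (Fin n))ᶜ).card := by
    have h₄ : ({v, a₁, a₂, a₃} : Finset (Fin n)).card ≤ 4 := Finset.card_le_four
    rw [Finset.card_compl, Fintype.card_fin]
    omega
  obtain ⟨w, hw⟩ := Finset.card_pos.1 ((Nat.succ_pos 5).trans_le hS)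
  have hsub : ({v, a₁, a₂, a₃} : Finset (Fin n))ᶜ.erase w ⊆ (redGraph n c).neighborFinset w := by
    intro u hu
    simp only [Finset.mem_erase, Finset.mem_compl, Finset.mem_insert, Finset.mem_singleton,
      not_or] at hu hw
    rw [SimpleGraph.mem_neighborFinset]
    refine ⟨hu.1.symm, ?_⟩
    by_contra hred
    refine hcon ⟨v, a₁, a₂, a₃, w, u, ?_, h₁.2, h₂.2, h₃.2, by simpa using hred⟩
    simp only [List.nodup_cons, List.mem_cons, List.not_mem_nil, or_false, not_or, List.nodup_nil,
      not_false_eq_true, and_true]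
    tauto
  have hdeg := Finset.card_le_card hsub
  rw [Finset.card_erase_of_mem hw, SimpleGraph.card_neighborFinset_eq_degree] at hdeg
  obtain ⟨x, y, hxy, hx, hy, hc⟩ := exists_blue_edge_avoiding (Nat.le_of_succ_le hB) w
  exact hcon (exists_redStar_blueEdge_of_five_le_degree (by omega) hxy hx hy hc)
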